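/- Let G be a simple graph on n ≥ 1 vertices with adjacency matrix A, let h > 0, let (c_k)_{k∈ℕ} be real coefficients with c_3 ≠ 0 and |c_k| ≤ |c_3|·h^{k-3} for all k ≥ 4, and let f : ℝ → ℝ be nonnegative on (0,2) and satisfy f(x) = Σ_{k=0}^∞ c_k (x-1)^k for every x ∈ (0,2) with |x-1| ≤ 1/(10h). Set δ = min(1/n, 1/(10·n^4·h)), and let ε₁ ∈ (0,1] satisfy ε₁·|c_0|·n ≤ |c_3|·δ³ and ε₁·|c_2|·n² ≤ |c_3|·δ. Suppose X ∈ ℝ satisfies |X - S| ≤ (ε₁/9)·S, where S = Σ_{i=1}^n f(λ_i(I + δA)). Then: if G has no triangle (equivalently tr(A³) = 0), then |X - c_0·n - c_2·δ²·tr(A²)| < |c_3|·δ³; and if G contains at least one triangle (so that tr(A³) ≥ 6), then |X - c_0·n - c_2·δ²·tr(A²)| > |c_3|·δ³. In particular, any (1 ± ε₁/9)-approximation to the spectral sum S determines whether G contains a triangle. -/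

import Mathlib

/-- A power series with coefficients dominated by `|c 3| * h ^ (k - 3)` from degree four on is
approximated by its cubic Taylor polynomial. -/
lemma abs_sub_cubic_le {c : ℕ → ℝ} {h x y : ℝ} (hh : 0 < h)
    (hc : ∀ k : ℕ, 4 ≤ k → |c k| ≤ |c 3| * h ^ (k - 3)) (hx : h * |x| < 1)
    (hy : HasSum (fun k : ℕ => c k * x ^ k) y) :
    |y - (c 0 + c 1 * x + c 2 * x ^ 2 + c 3 * x ^ 3)| ≤
      |c 3| * |x| ^ 3 * (h * |x|) * (1 - h * |x|)⁻¹ := by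
  have h1 := (hasSum_nat_add_iff' 4).2 hy
  have h2 := (hasSum_geometric_of_lt_one (by positivity) hx).mul_left
    (|c 3| * |x| ^ 3 * (h * |x|))
  have h3 := h1.norm_le_of_bounded h2 fun k => by
    rw [Real.norm_eq_abs, abs_mul, abs_pow]
    calc |c (k + 4)| * |x| ^ (k + 4) ≤ |c 3| * h ^ (k + 1) * |x| ^ (k + 4) := by
          gcongr
          exact hc (k + 4) (by omega)
      _ = _ := by ring
  simpa [Finset.sum_range_succ] using h3

/-- The power sums of the shifted eigenvalues are the traces of powers of the shifted matrix. -/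
lemma Matrix.IsHermitian.sum_eigenvalues_sub_one_pow {m : Type*} [Fintype m] [DecidableEq m]
    {M : Matrix m m ℝ} (hM : M.IsHermitian) (k : ℕ) :
    ∑ i, (hM.eigenvalues i - 1) ^ k = Matrix.trace ((M - 1) ^ k) := by
  have h1 : M - 1 = Unitary.conjStarAlgAut ℝ _ hM.eigenvectorUnitary
      (Matrix.diagonal fun i => hM.eigenvalues i - 1) := by
    have h2 : (Matrix.diagonal fun i => hM.eigenvalues i - 1) =
        Matrix.diagonal (RCLike.ofReal ∘ hM.eigenvalues) - (1 : Matrix m m ℝ) := by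
      rw [← Matrix.diagonal_one, Matrix.diagonal_sub]
      rfl
    rw [h2, map_sub, map_one, ← hM.spectral_theorem]
  rw [h1, ← map_pow, Unitary.conjStarAlgAut_apply, Matrix.trace_mul_cycle, Matrix.diagonal_pow]
  simp [Matrix.trace_diagonal]

/-- Gershgorin bound for the eigenvalues of `1 + δ • A`. -/
lemma SimpleGraph.abs_eigenvalues_one_add_smul_adjMatrix_sub_one_le {V : Type*} [Fintype V]
    [DecidableEq V] (G : SimpleGraph V) [DecidableRel G.Adj] {δ : ℝ} (hδ : 0 ≤ δ)
    (hH : ((1 : Matrix V V ℝ) + δ • G.adjMatrix ℝ).IsHermitian) (i : V) :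
    |hH.eigenvalues i - 1| ≤ δ * (Fintype.card V - 1) := by
  have hev : Module.End.HasEigenvalue
      (Matrix.toLin' ((1 : Matrix V V ℝ) + δ • G.adjMatrix ℝ)) (hH.eigenvalues i) := by
    rw [Module.End.hasEigenvalue_iff_mem_spectrum, Matrix.spectrum_toLin']
    exact hH.eigenvalues_mem_spectrum_real i
  obtain ⟨k, hk⟩ := eigenvalue_mem_ball hev
  rw [Metric.mem_closedBall, Real.dist_eq] at hk
  have hcard : ((Finset.univ.erase k).card : ℝ) = Fintype.card V - 1 := by
    rw [Finset.card_erase_of_mem (Finset.mem_univ k), Finset.card_univ,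
      Nat.cast_sub (Fintype.card_pos_iff.2 ⟨k⟩), Nat.cast_one]
  calc |hH.eigenvalues i - 1| ≤
      ∑ j ∈ Finset.univ.erase k, ‖((1 : Matrix V V ℝ) + δ • G.adjMatrix ℝ) k j‖ := by
        simpa using hk
    _ ≤ ∑ j ∈ Finset.univ.erase k, δ := by
        refine Finset.sum_le_sum fun j hj => ?_
        have hjk : k ≠ j := (Finset.ne_of_mem_erase hj).symm
        by_cases hadj : G.Adj k j <;>
          simp [Matrix.one_apply_ne hjk, hadj, abs_of_nonneg hδ, hδ]
    _ = δ * (Fintype.card V - 1) := by rw [Finset.sum_const, nsmul_eq_mul, hcard, mul_comm]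

lemma SimpleGraph.trace_adjMatrix_pow_nonneg {V : Type*} [Fintype V] [DecidableEq V]
    (G : SimpleGraph V) [DecidableRel G.Adj] (k : ℕ) :
    0 ≤ Matrix.trace (G.adjMatrix ℝ ^ k) :=
  Finset.sum_nonneg fun i _ => by
    rw [Matrix.diag_apply, G.adjMatrix_pow_apply_eq_card_walk]
    exact Nat.cast_nonneg _

lemma SimpleGraph.trace_adjMatrix_sq_le {V : Type*} [Fintype V] [DecidableEq V]
    (G : SimpleGraph V) [DecidableRel G.Adj] :
    Matrix.trace (G.adjMatrix ℝ ^ 2) ≤ (Fintype.card V : ℝ) ^ 2 := by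
  calc Matrix.trace (G.adjMatrix ℝ ^ 2) = ∑ i, (G.degree i : ℝ) :=
        Finset.sum_congr rfl fun i _ => by
          rw [Matrix.diag_apply, sq, G.adjMatrix_mul_self_apply_self]
    _ ≤ ∑ _i : V, (Fintype.card V : ℝ) := by
        gcongr with i
        exact (G.degree_lt_card_verts i).le
    _ = _ := by simp [sq]


/-- an accurate `(1 ± ε₁/9)`-approximation `X` to the spectral sum
`S = ∑ᵢ f(λᵢ(I + δA))` distinguishes triangle-free graphs from graphs with a triangle:
if `tr(A³) = 0` then `|X - c₀n - c₂δ²tr(A²)| < |c₃|δ³`, while if `tr(A³) ≥ 6` then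
`|X - c₀n - c₂δ²tr(A²)| > |c₃|δ³`. -/
theorem stmt_6 (n : ℕ) (hn : 1 ≤ n) (G : SimpleGraph (Fin n)) [DecidableRel G.Adj]
    (h : ℝ) (hh : 0 < h) (c : ℕ → ℝ) (hc3 : c 3 ≠ 0)
    (hc : ∀ k : ℕ, 4 ≤ k → |c k| ≤ |c 3| * h ^ (k - 3))
    (f : ℝ → ℝ)
    (hfnonneg : ∀ x ∈ Set.Ioo (0 : ℝ) 2, 0 ≤ f x)
    (hf : ∀ x ∈ Set.Ioo (0 : ℝ) 2, |x - 1| ≤ 1 / (10 * h) →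
      HasSum (fun k : ℕ => c k * (x - 1) ^ k) (f x))
    (δ : ℝ) (hδ : δ = min (1 / (n : ℝ)) (1 / (10 * (n : ℝ) ^ 4 * h)))
    (ε₁ : ℝ) (hε₁ : ε₁ ∈ Set.Ioc (0 : ℝ) 1)
    (hε₁c0 : ε₁ * |c 0| * n ≤ |c 3| * δ ^ 3)
    (hε₁c2 : ε₁ * |c 2| * n ^ 2 ≤ |c 3| * δ)
    (hH : ((1 : Matrix (Fin n) (Fin n) ℝ) + δ • G.adjMatrix ℝ).IsHermitian)
    (S : ℝ) (hS : S = ∑ i, f (hH.eigenvalues i))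
    (X : ℝ) (hX : |X - S| ≤ ε₁ / 9 * S) :
    (Matrix.trace ((G.adjMatrix ℝ) ^ 3) = 0 →
      |X - c 0 * n - c 2 * δ ^ 2 * Matrix.trace ((G.adjMatrix ℝ) ^ 2)| < |c 3| * δ ^ 3) ∧
    (6 ≤ Matrix.trace ((G.adjMatrix ℝ) ^ 3) →
      |X - c 0 * n - c 2 * δ ^ 2 * Matrix.trace ((G.adjMatrix ℝ) ^ 2)| > |c 3| * δ ^ 3) := by

  set T2 := Matrix.trace ((G.adjMatrix ℝ) ^ 2)
  set T3 := Matrix.trace ((G.adjMatrix ℝ) ^ 3)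
  have hn1 : (1 : ℝ) ≤ n := by exact_mod_cast hn
  have hn0 : (0 : ℝ) < n := by linarith
  have hδ0 : 0 < δ := by rw [hδ]; positivity
  have hδn : δ * n ≤ 1 := by
    have : δ ≤ 1 / (n : ℝ) := hδ ▸ min_le_left _ _
    rwa [le_div_iff₀ hn0] at this
  have hδh : δ * (10 * (n : ℝ) ^ 4 * h) ≤ 1 := by
    have : δ ≤ 1 / (10 * (n : ℝ) ^ 4 * h) := hδ ▸ min_le_right _ _
    rwa [le_div_iff₀ (by positivity)] at this
  have hT2nonneg : 0 ≤ T2 := G.trace_adjMatrix_pow_nonneg 2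
  have hT2le : T2 ≤ (n : ℝ) ^ 2 := by simpa using G.trace_adjMatrix_sq_le
  have hc3pos : 0 < |c 3| := abs_pos.2 hc3
  set D := |c 3| * δ ^ 3 with hD
  have hD0 : 0 < D := by positivity
  set μ : Fin n → ℝ := fun i => hH.eigenvalues i - 1 with hμ
  have hμabs (i) : |μ i| ≤ δ * (n - 1) := by
    simpa using G.abs_eigenvalues_one_add_smul_adjMatrix_sub_one_le hδ0.le hH i
  have hpow (k : ℕ) : ∑ i, μ i ^ k = δ ^ k * Matrix.trace (G.adjMatrix ℝ ^ k) := by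
    rw [hH.sum_eigenvalues_sub_one_pow k, add_sub_cancel_left, smul_pow, Matrix.trace_smul,
      smul_eq_mul]
  have hlocal (i) : |f (hH.eigenvalues i) -
      (c 0 + c 1 * μ i + c 2 * μ i ^ 2 + c 3 * μ i ^ 3)| ≤
        |c 3| * δ / (9 * n ^ 2) * μ i ^ 2 := by
    have hlt : |μ i| < 1 := (hμabs i).trans_lt (by linarith)
    have hle : |μ i| ≤ δ * n := (hμabs i).trans (by linarith)
    have hq : h * |μ i| * (10 * n ^ 3) ≤ 1 := by
      calc h * |μ i| * (10 * n ^ 3) ≤ h * (δ * n) * (10 * n ^ 3) := by gcongr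
        _ = δ * (10 * (n : ℝ) ^ 4 * h) := by ring
        _ ≤ 1 := hδh
    have hq0 : 0 ≤ h * |μ i| := by positivity
    have hn3 : (1 : ℝ) ≤ n ^ 3 := one_le_pow₀ hn1
    have hq1 : h * |μ i| * 10 ≤ 1 := by nlinarith
    have hmem : hH.eigenvalues i ∈ Set.Ioo (0 : ℝ) 2 := by
      have := abs_lt.1 hlt
      simp only [hμ] at this
      constructor <;> linarith
    have hrad : |hH.eigenvalues i - 1| ≤ 1 / (10 * h) := by
      rw [le_div_iff₀ (by positivity)]
      simp only [hμ] at hq1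
      linarith
    refine (abs_sub_cubic_le hh hc (by linarith) (hf _ hmem hrad)).trans ?_
    have hinv : 0 ≤ (1 - h * |μ i|)⁻¹ := inv_nonneg.2 (by linarith)
    have hgeom : h * |μ i| * (1 - h * |μ i|)⁻¹ ≤ 1 / (9 * n ^ 3) := by
      rw [← div_eq_mul_inv, div_le_div_iff₀ (by linarith) (by positivity)]
      linarith
    calc |c 3| * |μ i| ^ 3 * (h * |μ i|) * (1 - h * |μ i|)⁻¹
        = |c 3| * |μ i| * |μ i| ^ 2 * (h * |μ i| * (1 - h * |μ i|)⁻¹) := by ring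
      _ ≤ |c 3| * (δ * n) * |μ i| ^ 2 * (1 / (9 * n ^ 3)) := by gcongr
      _ = |c 3| * δ / (9 * n ^ 2) * μ i ^ 2 := by
          rw [sq_abs]
          field_simp
  have hE : |S - (c 0 * n + c 2 * δ ^ 2 * T2 + c 3 * δ ^ 3 * T3)| ≤ D / 9 := by
    have hsum : S - (c 0 * n + c 2 * δ ^ 2 * T2 + c 3 * δ ^ 3 * T3) =
        ∑ i, (f (hH.eigenvalues i) - (c 0 + c 1 * μ i + c 2 * μ i ^ 2 + c 3 * μ i ^ 3)) := by
      have h1 : ∑ i, μ i = 0 := by simpa using hpow 1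
      simp only [Finset.sum_sub_distrib, Finset.sum_add_distrib, ← Finset.mul_sum, hpow 2, hpow 3,
        h1, hS]
      simp
      ring
    rw [hsum]
    calc _ ≤ ∑ i, |c 3| * δ / (9 * n ^ 2) * μ i ^ 2 :=
          (Finset.abs_sum_le_sum_abs _ _).trans (Finset.sum_le_sum fun i _ => hlocal i)
      _ = |c 3| * δ / (9 * n ^ 2) * (δ ^ 2 * T2) := by rw [← Finset.mul_sum, hpow 2]
      _ ≤ |c 3| * δ / (9 * n ^ 2) * (δ ^ 2 * n ^ 2) := by gcongr
      _ = D / 9 := by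
          rw [hD]
          field_simp
  obtain ⟨hε0, hε1⟩ := hε₁
  have hA0 : ε₁ * (c 0 * n) ≤ D := by
    refine le_trans ?_ hε₁c0
    rw [mul_assoc]
    gcongr
    exact le_abs_self _
  have hA2 : ε₁ * (c 2 * δ ^ 2 * T2) ≤ D := by
    calc ε₁ * (c 2 * δ ^ 2 * T2) ≤ ε₁ * (|c 2| * δ ^ 2 * n ^ 2) := by
          gcongr
          exact le_abs_self _
      _ = ε₁ * |c 2| * n ^ 2 * δ ^ 2 := by ring
      _ ≤ |c 3| * δ * δ ^ 2 := by gcongr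
      _ = D := by ring
  have hT3nonneg : 0 ≤ T3 := G.trace_adjMatrix_pow_nonneg 3
  have habs3 : |c 3 * δ ^ 3 * T3| = D * T3 := by
    rw [abs_mul, abs_mul, abs_of_nonneg hT3nonneg, abs_of_pos (pow_pos hδ0 3)]
  have hDT : 0 ≤ D * T3 := by positivity
  have hA3 : ε₁ * (c 3 * δ ^ 3 * T3 + D / 9) ≤ D * T3 + D / 9 := by
    have h1 : c 3 * δ ^ 3 * T3 ≤ D * T3 := habs3 ▸ le_abs_self _
    calc ε₁ * (c 3 * δ ^ 3 * T3 + D / 9) ≤ ε₁ * (D * T3 + D / 9) := by gcongr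
      _ ≤ 1 * (D * T3 + D / 9) := by gcongr
      _ = _ := one_mul _
  have hεS : ε₁ * S ≤ 2 * D + D * T3 + D / 9 := by
    have h1 : S ≤ c 0 * n + c 2 * δ ^ 2 * T2 + (c 3 * δ ^ 3 * T3 + D / 9) := by
      linarith [(abs_le.1 hE).2]
    calc ε₁ * S ≤ ε₁ * (c 0 * n + c 2 * δ ^ 2 * T2 + (c 3 * δ ^ 3 * T3 + D / 9)) := by gcongr
      _ ≤ _ := by linarith
  have hdev : |X - c 0 * n - c 2 * δ ^ 2 * T2 - c 3 * δ ^ 3 * T3| ≤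
      (2 * D + D * T3 + D / 9) / 9 + D / 9 := by
    rw [abs_le] at hX hE ⊢
    constructor <;> linarith [hX.1, hX.2, hE.1, hE.2]
  constructor
  · intro h0
    rw [h0] at hdev
    simp only [mul_zero, sub_zero] at hdev
    linarith
  · intro h6
    have hD6 : D * 6 ≤ D * T3 := by gcongr
    have := abs_sub_abs_le_abs_sub (c 3 * δ ^ 3 * T3) (X - c 0 * n - c 2 * δ ^ 2 * T2)
    rw [abs_sub_comm (c 3 * δ ^ 3 * T3), habs3] at this
    linarith
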